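/- arXiv:1406.0207 — 2 statements merged into one kernel-verified Lean document; each statement's English description precedes it below -/
import Mathlib

section
/- Let ρ = (√5 − 1)/2, let S_1(x) = ρx and S_2(x) = ρx + (1 − ρ), and let μ be a Borel probability measure on ℝ with support contained in [0,1] satisfying μ(A) = (1/2) μ(S_1^{-1}(A)) + (1/2) μ(S_2^{-1}(A)) for every Borel set A ⊆ ℝ. Then ∫_{[0,ρ²]} x dμ(x) = ρ²/(6(3ρ − 1)) and ∫_{[ρ²,ρ]} x dμ(x) = 1/6. -/
open MeasureTheory Set

/-- For the infinite Bernoulli convolution `μ` associated with the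
golden ratio `ρ = (√5 − 1)/2`, one has `∫_{[0,ρ²]} x dμ = ρ²/(6(3ρ − 1))` and
`∫_{[ρ²,ρ]} x dμ = 1/6`. -/
theorem bernoulli_convolution_first_moments
    (ρ : ℝ) (hρ : ρ = (Real.sqrt 5 - 1) / 2)
    (μ : Measure ℝ) [IsProbabilityMeasure μ]
    (hsupp : μ (Set.Icc (0 : ℝ) 1)ᶜ = 0)
    (hself : ∀ A : Set ℝ, MeasurableSet A →
      μ A = (1 / 2) * μ ((fun x => ρ * x) ⁻¹' A) +
            (1 / 2) * μ ((fun x => ρ * x + (1 - ρ)) ⁻¹' A)) :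
    (∫ x in Set.Icc 0 (ρ ^ 2), x ∂μ) = ρ ^ 2 / (6 * (3 * ρ - 1)) ∧
    (∫ x in Set.Icc (ρ ^ 2) ρ, x ∂μ) = 1 / 6 := by
  have hs5 : Real.sqrt 5 ^ 2 = 5 := Real.sq_sqrt (by norm_num)
  have hs2 : 2 < Real.sqrt 5 := Real.lt_sqrt_of_sq_lt (by norm_num)
  have hs3 : Real.sqrt 5 < 3 := by nlinarith
  have hr0 : 0 < ρ := by rw [hρ]; linarith
  have hr1 : ρ < 1 := by rw [hρ]; linarith
  have hrh : 1 / 2 < ρ := by rw [hρ]; linarith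
  have hrr : ρ ^ 2 = 1 - ρ := by rw [hρ]; linear_combination hs5 / 4
  clear hρ hs5 hs2 hs3
  have hm1 : Measurable (fun x : ℝ => ρ * x) := by fun_prop
  have hm2 : Measurable (fun x : ℝ => ρ * x + (1 - ρ)) := by fun_prop
  have hae : ∀ᵐ x ∂μ, x ∈ Set.Icc (0 : ℝ) 1 := by
    rw [ae_iff]; exact hsupp
  have hint : Integrable (fun x : ℝ => x) μ := by
    refine Integrable.of_bound (by fun_prop) 1 ?_
    filter_upwards [hae] with x hx
    rw [Real.norm_eq_abs, abs_le]
    constructor <;> linarith [hx.1, hx.2]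
  -- measures of sets
  have hreal : ∀ A : Set ℝ, MeasurableSet A →
      μ.real A = (1 / 2) * μ.real ((fun x => ρ * x) ⁻¹' A) +
            (1 / 2) * μ.real ((fun x => ρ * x + (1 - ρ)) ⁻¹' A) := by
    intro A hA
    have h := congrArg ENNReal.toReal (hself A hA)
    rw [ENNReal.toReal_add (ENNReal.mul_ne_top (by simp) (measure_ne_top _ _))
      (ENNReal.mul_ne_top (by simp) (measure_ne_top _ _)), ENNReal.toReal_mul,
      ENNReal.toReal_mul] at h
    simpa [Measure.real] using h
  have hmeas : μ = (1 / 2 : ENNReal) • μ.map (fun x => ρ * x) +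
      (1 / 2 : ENNReal) • μ.map (fun x => ρ * x + (1 - ρ)) := by
    ext A hA
    rw [Measure.add_apply, Measure.smul_apply, Measure.smul_apply, Measure.map_apply hm1 hA,
      Measure.map_apply hm2 hA]
    exact hself A hA
  have hG : ∀ A : Set ℝ, MeasurableSet A →
      ∫ x in A, x ∂μ = (1 / 2) * (ρ * ∫ x in (fun x => ρ * x) ⁻¹' A, x ∂μ) +
        (1 / 2) * (ρ * (∫ x in (fun x => ρ * x + (1 - ρ)) ⁻¹' A, x ∂μ) +
          (1 - ρ) * μ.real ((fun x => ρ * x + (1 - ρ)) ⁻¹' A)) := by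
    intro A hA
    have i1 : Integrable (fun x : ℝ => x) (μ.map (fun x => ρ * x)) := by
      rw [integrable_map_measure (by fun_prop) (by fun_prop)]
      exact hint.const_mul ρ
    have i2 : Integrable (fun x : ℝ => x) (μ.map (fun x => ρ * x + (1 - ρ))) := by
      rw [integrable_map_measure (by fun_prop) (by fun_prop)]
      exact (hint.const_mul ρ).add (integrable_const _)
    conv_lhs => rw [hmeas]
    rw [Measure.restrict_add, Measure.restrict_smul, Measure.restrict_smul,
      integral_add_measure (i1.integrableOn.smul_measure (by simp))
        (i2.integrableOn.smul_measure (by simp)),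
      integral_smul_measure, integral_smul_measure,
      setIntegral_map hA (by fun_prop) (by fun_prop),
      setIntegral_map hA (by fun_prop) (by fun_prop),
      integral_add (hint.integrableOn.const_mul ρ) (integrable_const _),
      integral_const_mul, integral_const_mul, integral_const]
    simp [mul_comm]
  have p1 : ∀ c d : ℝ, c = ρ * d → (fun x => ρ * x) ⁻¹' (Set.Iic c) = Set.Iic d := by
    intro c d h
    ext x
    simp only [Set.mem_preimage, Set.mem_Iic, h]
    exact mul_le_mul_iff_right₀ hr0
  have p2 : ∀ c d : ℝ, c = ρ * d + (1 - ρ) →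
      (fun x => ρ * x + (1 - ρ)) ⁻¹' (Set.Iic c) = Set.Iic d := by
    intro c d h
    ext x
    simp only [Set.mem_preimage, Set.mem_Iic, h, add_le_add_iff_right]
    exact mul_le_mul_iff_right₀ hr0
  have q1 : ∀ c d : ℝ, c = ρ * d → (fun x => ρ * x) ⁻¹' {c} = {d} := by
    intro c d h
    ext x
    simp [h, hr0.ne']
  have q2 : ∀ c d : ℝ, c = ρ * d + (1 - ρ) →
      (fun x => ρ * x + (1 - ρ)) ⁻¹' {c} = {d} := by
    intro c d h
    ext x
    simp [h, hr0.ne']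
  have hneg : ∀ A : Set ℝ, A ⊆ (Set.Icc (0 : ℝ) 1)ᶜ → μ.real A = 0 := by
    intro A hA
    simp [Measure.real, measure_mono_null hA hsupp]
  -- distribution function
  obtain ⟨e, he⟩ : ∃ e : ℝ, ρ * e = 1 := ⟨ρ⁻¹, mul_inv_cancel₀ hr0.ne'⟩
  have he1 : 1 < e := by nlinarith
  have M0 : μ.real (Set.Iic 0) = 0 := by
    have h := hreal (Set.Iic 0) measurableSet_Iic
    rw [p1 0 0 (by ring), p2 0 (-ρ) (by linarith)] at h
    have := hneg (Set.Iic (-ρ)) (by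
      intro x hx hx'
      simp only [Set.mem_Iic] at hx
      linarith [hx'.1])
    linarith
  have M0' : μ (Set.Iic 0) = 0 := by
    simpa [Measure.real, ENNReal.toReal_eq_zero_iff] using M0
  have M1 : μ.real (Set.Iic 1) = 1 := by
    have : μ (Set.Iic 1) = 1 := by
      exact (prob_compl_eq_zero_iff measurableSet_Iic).1 
        (measure_mono_null (Set.compl_subset_compl.2 Set.Icc_subset_Iic_self) hsupp)
    simp [Measure.real, this]
  have a0 : μ.real {(0 : ℝ)} = 0 := by
    simp [Measure.real, measure_mono_null (by simp : {(0 : ℝ)} ⊆ Set.Iic 0) M0']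
  have a1 : μ.real {(1 : ℝ)} = 0 := by
    have h := hreal {1} (measurableSet_singleton _)
    rw [q1 1 e he.symm, q2 1 1 (by ring)] at h
    have := hneg {e} (by
      rintro x rfl hx
      linarith [hx.2])
    linarith
  have a2 : μ.real {ρ ^ 2} = 0 := by
    have h := hreal {ρ ^ 2} (measurableSet_singleton _)
    have h' := hreal {ρ} (measurableSet_singleton _)
    rw [q1 (ρ ^ 2) ρ (by ring), q2 (ρ ^ 2) 0 (by linarith)] at h
    rw [q1 ρ 1 (by ring), q2 ρ (ρ ^ 2) (by linear_combination (1 - ρ) * hrr)] at h'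
    linarith
  have a2' : μ {ρ ^ 2} = 0 := by
    simpa [Measure.real, ENNReal.toReal_eq_zero_iff] using a2
  have k : ρ = ρ * ρ ^ 2 + (1 - ρ) := by linear_combination (1 - ρ) * hrr
  have Ma := hreal (Set.Iic (ρ ^ 2)) measurableSet_Iic
  rw [p1 (ρ ^ 2) ρ (by ring), p2 (ρ ^ 2) 0 (by linarith)] at Ma
  have Mb := hreal (Set.Iic ρ) measurableSet_Iic
  rw [p1 ρ 1 (by ring), p2 ρ (ρ ^ 2) k] at Mb
  have Ga := hG (Set.Iic (ρ ^ 2)) measurableSet_Iic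
  rw [p1 (ρ ^ 2) ρ (by ring), p2 (ρ ^ 2) 0 (by linarith)] at Ga
  have Gb := hG (Set.Iic ρ) measurableSet_Iic
  rw [p1 ρ 1 (by ring), p2 ρ (ρ ^ 2) k] at Gb
  have Gc := hG (Set.Iic 1) measurableSet_Iic
  rw [p1 1 e he.symm, p2 1 1 (by ring)] at Gc
  have G0 : ∫ x in Set.Iic (0 : ℝ), x ∂μ = 0 := setIntegral_measure_zero _ M0'
  have Ge : ∫ x in Set.Iic e, x ∂μ = ∫ x in Set.Iic (1 : ℝ), x ∂μ := by
    apply setIntegral_congr_set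
    filter_upwards [hae] with x hx
    apply propext
    exact ⟨fun _ => hx.2, fun _ => hx.2.trans he1.le⟩
  have E1 : ∫ x in Set.Icc 0 (ρ ^ 2), x ∂μ = ∫ x in Set.Iic (ρ ^ 2), x ∂μ := by
    apply setIntegral_congr_set
    filter_upwards [hae] with x hx
    apply propext
    exact ⟨fun h => h.2, fun h => ⟨hx.1, h⟩⟩
  have E2 : ∫ x in Set.Icc (ρ ^ 2) ρ, x ∂μ =
      (∫ x in Set.Iic ρ, x ∂μ) - ∫ x in Set.Iic (ρ ^ 2), x ∂μ := by
    have h1 : ∫ x in Set.Icc (ρ ^ 2) ρ, x ∂μ = ∫ x in Set.Ioc (ρ ^ 2) ρ, x ∂μ :=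
      setIntegral_congr_set (Ioc_ae_eq_Icc' a2').symm
    have h2 : Set.Iic ρ = Set.Iic (ρ ^ 2) ∪ Set.Ioc (ρ ^ 2) ρ :=
      (Set.Iic_union_Ioc_eq_Iic (by nlinarith)).symm
    rw [h1, h2, setIntegral_union (Set.Iic_disjoint_Ioc le_rfl) measurableSet_Ioc
      hint.integrableOn hint.integrableOn]
    ring
  rw [E1, E2]
  rw [G0, M0] at Ga
  rw [M0] at Ma
  rw [M1] at Mb Gc
  rw [Ge] at Gc
  have Mv : μ.real (Set.Iic (ρ ^ 2)) = 1 / 3 := by linarith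
  rw [Mv] at Gb
  generalize (∫ x in Set.Iic (ρ ^ 2), x ∂μ) = u at *
  generalize (∫ x in Set.Iic ρ, x ∂μ) = v at *
  generalize (∫ x in Set.Iic (1 : ℝ), x ∂μ) = t at *
  have ht : t = 1 / 2 := by
    have : (1 - ρ) * (t - 1 / 2) = 0 := by linear_combination Gc
    rcases mul_eq_zero.1 this with h | h <;> linarith
  subst ht
  have hB : v - u = 1 / 6 := by
    have : (1 + ρ / 2) * (v - u - 1 / 6) = 0 := by linear_combination Gb - Ga
    rcases mul_eq_zero.1 this with h | h <;> linarith
  refine ⟨?_, hB⟩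
  rw [eq_div_iff (by linarith)]
  have hv : v = u + 1 / 6 := by linarith
  subst hv
  have hu : (2 - ρ) * u = ρ / 6 := by linear_combination 2 * Ga
  linear_combination 6 * ρ * hu + 6 * u * hrr
end

section
/- For i = 1, 2, 3, 4 let S_i(x) = (1/3)x + (2/3)(i − 1), and let μ be a Borel probability measure on ℝ with support contained in [0,3] satisfying μ(A) = (1/8) μ(S_1^{-1}(A)) + (3/8) μ(S_2^{-1}(A)) + (3/8) μ(S_3^{-1}(A)) + (1/8) μ(S_4^{-1}(A)) for every Borel set A ⊆ ℝ. Then ∫_{[0,1]} x² dμ(x) = 613/6440, ∫_{[1,2]} (x − 1)² dμ(x) = 1327/6440, and ∫_{[2,3]} (x − 2)² dμ(x) = 7/184. -/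
open MeasureTheory Set

/-- Measurable and bounded on `[0,3]`. -/
def NiceFn (f : ℝ → ℝ) : Prop :=
  Measurable f ∧ ∃ C : ℝ, ∀ x, 0 ≤ x → x ≤ 3 → |f x| ≤ C

lemma NiceFn.pow (k : ℕ) : NiceFn (fun x => x ^ k) := by
  refine ⟨by fun_prop, 3 ^ k, fun x h0 h3 => ?_⟩
  dsimp only
  rw [abs_of_nonneg (by positivity)]
  gcongr

lemma NiceFn.low (k : ℕ) : NiceFn (fun x => if x ≤ 1 then x ^ k else 0) := by
  refine ⟨Measurable.ite measurableSet_Iic (by fun_prop) (by fun_prop), 3 ^ k, fun x h0 h3 => ?_⟩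
  dsimp only
  split_ifs
  · rw [abs_of_nonneg (by positivity)]
    gcongr
  · simp

lemma NiceFn.high (k : ℕ) : NiceFn (fun x => if 2 ≤ x then (x - 2) ^ k else 0) := by
  refine ⟨Measurable.ite measurableSet_Ici (by fun_prop) (by fun_prop), 3 ^ k, fun x h0 h3 => ?_⟩
  dsimp only
  split_ifs with h
  · have : 0 ≤ x - 2 := by linarith
    rw [abs_of_nonneg (by positivity)]
    gcongr
    linarith
  · simp

lemma NiceFn.point (t : ℝ) : NiceFn (fun x => if x = t then 1 else 0) := by
  refine ⟨Measurable.ite (measurableSet_singleton t) (by fun_prop) (by fun_prop), 1,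
    fun x h0 h3 => ?_⟩
  dsimp only
  split_ifs <;> simp

lemma NiceFn.comp {f : ℝ → ℝ} (hf : NiceFn f) (b : ℝ) (h0 : 0 ≤ b) (h2 : b ≤ 2) :
    NiceFn (fun x => f ((1 / 3) * x + b)) := by
  obtain ⟨hm, C, hC⟩ := hf
  exact ⟨hm.comp (by fun_prop), C, fun x hx hx3 => hC _ (by linarith) (by linarith)⟩

lemma ae_mem_of_supp {μ : Measure ℝ} (hsupp : μ (Set.Icc (0 : ℝ) 3)ᶜ = 0) :
    ∀ᵐ x ∂μ, 0 ≤ x ∧ x ≤ 3 := by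
  rw [ae_iff]
  exact hsupp

lemma NiceFn.integrable {μ : Measure ℝ} [IsProbabilityMeasure μ]
    (hsupp : μ (Set.Icc (0 : ℝ) 3)ᶜ = 0) {f : ℝ → ℝ} (hf : NiceFn f) : Integrable f μ := by
  obtain ⟨hm, C, hC⟩ := hf
  refine Integrable.of_bound hm.aestronglyMeasurable C ?_
  filter_upwards [ae_mem_of_supp hsupp] with x hx
  exact hC x hx.1 hx.2

lemma self_similar_integral {μ : Measure ℝ} [IsProbabilityMeasure μ]
    (hsupp : μ (Set.Icc (0 : ℝ) 3)ᶜ = 0)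
    (hself : ∀ A : Set ℝ, MeasurableSet A →
      μ A = (1 / 8) * μ ((fun x => (1 / 3) * x) ⁻¹' A) +
            (3 / 8) * μ ((fun x => (1 / 3) * x + 2 / 3) ⁻¹' A) +
            (3 / 8) * μ ((fun x => (1 / 3) * x + 4 / 3) ⁻¹' A) +
            (1 / 8) * μ ((fun x => (1 / 3) * x + 2) ⁻¹' A))
    {f : ℝ → ℝ} (hf : NiceFn f) :
    ∫ x, f x ∂μ = ∫ x, (1 / 8 * f ((1 / 3) * x) + 3 / 8 * f ((1 / 3) * x + 2 / 3)
      + 3 / 8 * f ((1 / 3) * x + 4 / 3) + 1 / 8 * f ((1 / 3) * x + 2)) ∂μ := by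
  have m0 : Measurable (fun x : ℝ => (1 / 3) * x) := by fun_prop
  have m1 : Measurable (fun x : ℝ => (1 / 3) * x + 2 / 3) := by fun_prop
  have m2 : Measurable (fun x : ℝ => (1 / 3) * x + 4 / 3) := by fun_prop
  have m3 : Measurable (fun x : ℝ => (1 / 3) * x + 2) := by fun_prop
  have i0 : Integrable (fun x => f ((1 / 3) * x)) μ := by
    simpa using (hf.comp 0 (by norm_num) (by norm_num)).integrable hsupp
  have i1 := (hf.comp (2 / 3) (by norm_num) (by norm_num)).integrable hsupp
  have i2 := (hf.comp (4 / 3) (by norm_num) (by norm_num)).integrable hsupp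
  have i3 := (hf.comp 2 (by norm_num) (by norm_num)).integrable hsupp
  have hμ : μ = (1 / 8 : ENNReal) • μ.map (fun x : ℝ => (1 / 3) * x)
      + (3 / 8 : ENNReal) • μ.map (fun x : ℝ => (1 / 3) * x + 2 / 3)
      + (3 / 8 : ENNReal) • μ.map (fun x : ℝ => (1 / 3) * x + 4 / 3)
      + (1 / 8 : ENNReal) • μ.map (fun x : ℝ => (1 / 3) * x + 2) := by
    ext A hA
    rw [hself A hA]
    simp only [Measure.add_apply, Measure.smul_apply, smul_eq_mul, Measure.map_apply m0 hA,
      Measure.map_apply m1 hA, Measure.map_apply m2 hA, Measure.map_apply m3 hA]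
  have sm (ν : Measure ℝ) : AEStronglyMeasurable f ν := hf.1.aestronglyMeasurable
  have t1 : (1 / 8 : ENNReal) ≠ ⊤ := ENNReal.div_ne_top (by simp) (by simp)
  have t3 : (3 / 8 : ENNReal) ≠ ⊤ := ENNReal.div_ne_top (by simp) (by simp)
  have j0 := ((integrable_map_measure (sm _) m0.aemeasurable).2 i0).smul_measure t1
  have j1 := ((integrable_map_measure (sm _) m1.aemeasurable).2 i1).smul_measure t3
  have j2 := ((integrable_map_measure (sm _) m2.aemeasurable).2 i2).smul_measure t3
  have j3 := ((integrable_map_measure (sm _) m3.aemeasurable).2 i3).smul_measure t1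
  have r1 : (1 / 8 : ENNReal).toReal = 1 / 8 := by simp
  have r3 : (3 / 8 : ENNReal).toReal = 3 / 8 := by simp
  conv_lhs => rw [hμ]
  rw [integral_add_measure ((j0.add_measure j1).add_measure j2) j3,
    integral_add_measure (j0.add_measure j1) j2, integral_add_measure j0 j1]
  simp only [integral_smul_measure, r1, r3, smul_eq_mul]
  rw [integral_map m0.aemeasurable (sm _), integral_map m1.aemeasurable (sm _),
    integral_map m2.aemeasurable (sm _), integral_map m3.aemeasurable (sm _)]
  rw [integral_add (by exact ((i0.const_mul _).add (i1.const_mul _)).add (i2.const_mul _))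
      (i3.const_mul _),
    integral_add (by exact (i0.const_mul _).add (i1.const_mul _)) (i2.const_mul _),
    integral_add (i0.const_mul _) (i1.const_mul _)]
  simp only [integral_const_mul]

lemma integral_comb {μ : Measure ℝ} [IsProbabilityMeasure μ]
    (hsupp : μ (Set.Icc (0 : ℝ) 3)ᶜ = 0) {F g0 g1 g2 g3 : ℝ → ℝ} (c0 c1 c2 c3 : ℝ)
    (h0 : NiceFn g0) (h1 : NiceFn g1) (h2 : NiceFn g2) (h3 : NiceFn g3)
    (h : ∀ᵐ x ∂μ, 0 ≤ x → x ≤ 3 → F x = c0 * g0 x + c1 * g1 x + c2 * g2 x + c3 * g3 x) :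
    ∫ x, F x ∂μ = c0 * ∫ x, g0 x ∂μ + c1 * ∫ x, g1 x ∂μ + c2 * ∫ x, g2 x ∂μ
      + c3 * ∫ x, g3 x ∂μ := by
  have i0 := h0.integrable hsupp
  have i1 := h1.integrable hsupp
  have i2 := h2.integrable hsupp
  have i3 := h3.integrable hsupp
  rw [← integral_const_mul, ← integral_const_mul, ← integral_const_mul, ← integral_const_mul,
    ← integral_add (by fun_prop) (by fun_prop), ← integral_add (by fun_prop) (by fun_prop),
    ← integral_add (by fun_prop) (by fun_prop)]
  refine integral_congr_ae ?_
  filter_upwards [h, ae_mem_of_supp hsupp] with x hx hm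
  exact hx hm.1 hm.2

lemma final_arith {m0 m1 m2 a0 a1 a2 c0 c1 c2 fp fl fh : ℝ} (z : m0 = 1)
    (M1 : m1 = 1/3 * m1 + 1 * m0 + 0 * m0 + 0 * m0)
    (M2 : m2 = 1/9 * m2 + 2/3 * m1 + 4/3 * m0 + 0 * m0)
    (A0 : a0 = 1/8 * m0 + 3/8 * a0 + 0 * m0 + 0 * m0)
    (A1 : a1 = 1/24 * m1 + 1/8 * a1 + 1/4 * a0 + 0 * m0)
    (A2 : a2 = 1/72 * m2 + 1/24 * a2 + 1/6 * a1 + 1/6 * a0)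
    (C0 : c0 = 1/8 * m0 + 3/8 * c0 + 0 * m0 + 0 * m0)
    (C1 : c1 = 1/24 * m1 + 1/8 * c1 + 0 * m0 + 0 * m0)
    (C2 : c2 = 1/72 * m2 + 1/24 * c2 + 0 * m0 + 0 * m0)
    (Fp : fp = 1 * m2 + -2 * m1 + 1 * m0 + 0 * m0)
    (Fl : fl = 1 * a2 + -2 * a1 + 1 * a0 + 0 * m0)
    (Fh : fh = 1 * c2 + 2 * c1 + 1 * c0 + 0 * m0) :
    a2 = 613 / 6440 ∧ 1 * fp + (-1) * fl + (-1) * fh + 0 * fp = 1327 / 6440 ∧ c2 = 7 / 184 := by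
  refine ⟨?_, ?_, ?_⟩ <;> linarith

lemma atom_arith {q0 q1 q2 q3 m : ℝ} (Q0 : q0 = 1/8 * q0 + 0 * m + 0 * m + 0 * m)
    (Q3 : q3 = 1/8 * q3 + 0 * m + 0 * m + 0 * m)
    (Q1 : q1 = 1/8 * q3 + 3/8 * q1 + 0 * m + 0 * m)
    (Q2 : q2 = 3/8 * q2 + 1/8 * q0 + 0 * m + 0 * m) : q1 = 0 ∧ q2 = 0 := by
  constructor <;> linarith

set_option maxHeartbeats 1000000 in
/-- For the 3-fold convolution of the Cantor measure `μ`, one has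
`∫_{[0,1]} x² dμ = 613/6440`, `∫_{[1,2]} (x−1)² dμ = 1327/6440`, and
`∫_{[2,3]} (x−2)² dμ = 7/184`. -/
theorem cantor_threefold_second_moments
    (μ : Measure ℝ) [IsProbabilityMeasure μ]
    (hsupp : μ (Set.Icc (0 : ℝ) 3)ᶜ = 0)
    (hself : ∀ A : Set ℝ, MeasurableSet A →
      μ A = (1 / 8) * μ ((fun x => (1 / 3) * x) ⁻¹' A) +
            (3 / 8) * μ ((fun x => (1 / 3) * x + 2 / 3) ⁻¹' A) +
            (3 / 8) * μ ((fun x => (1 / 3) * x + 4 / 3) ⁻¹' A) +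
            (1 / 8) * μ ((fun x => (1 / 3) * x + 2) ⁻¹' A)) :
    (∫ x in Set.Icc (0 : ℝ) 1, x ^ 2 ∂μ) = 613 / 6440 ∧
    (∫ x in Set.Icc (1 : ℝ) 2, (x - 1) ^ 2 ∂μ) = 1327 / 6440 ∧
    (∫ x in Set.Icc (2 : ℝ) 3, (x - 2) ^ 2 ∂μ) = 7 / 184 := by
  have S := fun {f : ℝ → ℝ} (hf : NiceFn f) => self_similar_integral hsupp hself hf
  have z : ∫ x : ℝ, x ^ 0 ∂μ = 1 := by simp
  have M1 := (S (NiceFn.pow 1)).trans (integral_comb hsupp (1/3) (1) (0) (0)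
    (NiceFn.pow 1) (NiceFn.pow 0) (NiceFn.pow 0) (NiceFn.pow 0)
    (Filter.Eventually.of_forall fun x h0 h3 => by
      clear * - h0 h3
      ring))
  have M2 := (S (NiceFn.pow 2)).trans (integral_comb hsupp (1/9) (2/3) (4/3) (0)
    (NiceFn.pow 2) (NiceFn.pow 1) (NiceFn.pow 0) (NiceFn.pow 0)
    (Filter.Eventually.of_forall fun x h0 h3 => by
      clear * - h0 h3
      ring))
  have A0 := (S (NiceFn.low 0)).trans (integral_comb hsupp (1/8) (3/8) (0) (0)
    (NiceFn.pow 0) (NiceFn.low 0) (NiceFn.pow 0) (NiceFn.pow 0)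
    (Filter.Eventually.of_forall fun x h0 h3 => by
      clear * - h0 h3
      try dsimp only
      split_ifs <;> first | (exfalso; linarith) | ring))
  have A1 := (S (NiceFn.low 1)).trans (integral_comb hsupp (1/24) (1/8) (1/4) (0)
    (NiceFn.pow 1) (NiceFn.low 1) (NiceFn.low 0) (NiceFn.pow 0)
    (Filter.Eventually.of_forall fun x h0 h3 => by
      clear * - h0 h3
      try dsimp only
      split_ifs <;> first | (exfalso; linarith) | ring))
  have A2 := (S (NiceFn.low 2)).trans (integral_comb hsupp (1/72) (1/24) (1/6) (1/6)
    (NiceFn.pow 2) (NiceFn.low 2) (NiceFn.low 1) (NiceFn.low 0)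
    (Filter.Eventually.of_forall fun x h0 h3 => by
      clear * - h0 h3
      try dsimp only
      split_ifs <;> first | (exfalso; linarith) | ring))
  have C0 := (S (NiceFn.high 0)).trans (integral_comb hsupp (1/8) (3/8) (0) (0)
    (NiceFn.pow 0) (NiceFn.high 0) (NiceFn.pow 0) (NiceFn.pow 0)
    (Filter.Eventually.of_forall fun x h0 h3 => by
      clear * - h0 h3
      try dsimp only
      split_ifs <;> first | (exfalso; linarith) | ring))
  have C1 := (S (NiceFn.high 1)).trans (integral_comb hsupp (1/24) (1/8) (0) (0)
    (NiceFn.pow 1) (NiceFn.high 1) (NiceFn.pow 0) (NiceFn.pow 0)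
    (Filter.Eventually.of_forall fun x h0 h3 => by
      clear * - h0 h3
      try dsimp only
      split_ifs <;> first | (exfalso; linarith) | ring))
  have C2 := (S (NiceFn.high 2)).trans (integral_comb hsupp (1/72) (1/24) (0) (0)
    (NiceFn.pow 2) (NiceFn.high 2) (NiceFn.pow 0) (NiceFn.pow 0)
    (Filter.Eventually.of_forall fun x h0 h3 => by
      clear * - h0 h3
      try dsimp only
      split_ifs <;> first | (exfalso; linarith) | ring))
  have Q0 := (S (NiceFn.point 0)).trans (integral_comb hsupp (1/8) (0) (0) (0)
    (NiceFn.point 0) (NiceFn.pow 0) (NiceFn.pow 0) (NiceFn.pow 0)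
    (Filter.Eventually.of_forall fun x h0 h3 => by
      clear * - h0 h3
      try dsimp only
      split_ifs <;> first | ring1 | (exfalso; linarith) | (exfalso; grind)))
  have Q3 := (S (NiceFn.point 3)).trans (integral_comb hsupp (1/8) (0) (0) (0)
    (NiceFn.point 3) (NiceFn.pow 0) (NiceFn.pow 0) (NiceFn.pow 0)
    (Filter.Eventually.of_forall fun x h0 h3 => by
      clear * - h0 h3
      try dsimp only
      split_ifs <;> first | ring1 | (exfalso; linarith) | (exfalso; grind)))
  have Q1 := (S (NiceFn.point 1)).trans (integral_comb hsupp (1/8) (3/8) (0) (0)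
    (NiceFn.point 3) (NiceFn.point 1) (NiceFn.pow 0) (NiceFn.pow 0)
    (Filter.Eventually.of_forall fun x h0 h3 => by
      clear * - h0 h3
      try dsimp only
      split_ifs <;> first | ring1 | (exfalso; linarith) | (exfalso; grind)))
  have Q2 := (S (NiceFn.point 2)).trans (integral_comb hsupp (3/8) (1/8) (0) (0)
    (NiceFn.point 2) (NiceFn.point 0) (NiceFn.pow 0) (NiceFn.pow 0)
    (Filter.Eventually.of_forall fun x h0 h3 => by
      clear * - h0 h3
      try dsimp only
      split_ifs <;> first | ring1 | (exfalso; linarith) | (exfalso; grind)))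
  have P1 : ∫ x : ℝ, (if x = 1 then (1 : ℝ) else 0) ∂μ = 0 := (atom_arith Q0 Q3 Q1 Q2).1
  have P2 : ∫ x : ℝ, (if x = 2 then (1 : ℝ) else 0) ∂μ = 0 := (atom_arith Q0 Q3 Q1 Q2).2
  have N (t : ℝ) (ht : ∫ x : ℝ, (if x = t then (1 : ℝ) else 0) ∂μ = 0) : ∀ᵐ x ∂μ, x ≠ t := by
    have h := (integral_eq_zero_iff_of_nonneg (fun x => by
      dsimp only [Pi.zero_apply]
      split_ifs <;> norm_num) ((NiceFn.point t).integrable hsupp)).1 ht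
    filter_upwards [h] with x hx hxt
    simp [hxt] at hx
  have N1 := N 1 P1
  have N2 := N 2 P2
  have E1 : (∫ x in Set.Icc (0 : ℝ) 1, x ^ 2 ∂μ) = ∫ x : ℝ, (if x ≤ 1 then x ^ 2 else 0) ∂μ := by
    rw [← integral_indicator measurableSet_Icc]
    refine integral_congr_ae ?_
    filter_upwards [ae_mem_of_supp hsupp] with x hx
    simp [Set.indicator_apply, hx.1]
  have E3 : (∫ x in Set.Icc (2 : ℝ) 3, (x - 2) ^ 2 ∂μ)
      = ∫ x : ℝ, (if 2 ≤ x then (x - 2) ^ 2 else 0) ∂μ := by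
    rw [← integral_indicator measurableSet_Icc]
    refine integral_congr_ae ?_
    filter_upwards [ae_mem_of_supp hsupp] with x hx
    simp [Set.indicator_apply, hx.2]
  -- shifted squares split into three pieces, using that `1` and `2` are not atoms
  have nl : NiceFn (fun x : ℝ => if x ≤ 1 then (x - 1) ^ 2 else 0) := by
    refine ⟨Measurable.ite measurableSet_Iic (by fun_prop) (by fun_prop), 1, fun x h0 h3 => ?_⟩
    dsimp only
    split_ifs with hx
    · rw [abs_of_nonneg (by positivity)]
      clear * - h0 h3 hx
      nlinarith
    · simp
  have nh : NiceFn (fun x : ℝ => if 2 ≤ x then (x - 1) ^ 2 else 0) := by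
    refine ⟨Measurable.ite measurableSet_Ici (by fun_prop) (by fun_prop), 4, fun x h0 h3 => ?_⟩
    dsimp only
    split_ifs with hx
    · rw [abs_of_nonneg (by positivity)]
      clear * - h0 h3 hx
      nlinarith
    · simp
  have np : NiceFn (fun x : ℝ => (x - 1) ^ 2) := by
    refine ⟨by fun_prop, 4, fun x h0 h3 => ?_⟩
    clear * - h0 h3
    dsimp only
    rw [abs_of_nonneg (by positivity)]
    clear * - h0 h3
    nlinarith
  have E2 : (∫ x in Set.Icc (1 : ℝ) 2, (x - 1) ^ 2 ∂μ) = 1 * ∫ x : ℝ, (x - 1) ^ 2 ∂μ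
      + (-1) * ∫ x : ℝ, (if x ≤ 1 then (x - 1) ^ 2 else 0) ∂μ
      + (-1) * ∫ x : ℝ, (if 2 ≤ x then (x - 1) ^ 2 else 0) ∂μ
      + 0 * ∫ x : ℝ, (x - 1) ^ 2 ∂μ := by
    rw [← integral_indicator measurableSet_Icc]
    refine integral_comb hsupp 1 (-1) (-1) 0 np nl nh np ?_
    filter_upwards [N1, N2] with x h1 h2 h0 h3
    clear * - h1 h2 h0 h3
    rw [Set.indicator_apply]
    simp only [Set.mem_Icc]
    split_ifs <;> first | ring1 | (exfalso; grind)
  have Fp := integral_comb hsupp (F := fun x => (x - 1) ^ 2) (1) (-2) (1) (0)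
    (NiceFn.pow 2) (NiceFn.pow 1) (NiceFn.pow 0) (NiceFn.pow 0)
    (Filter.Eventually.of_forall fun x h0 h3 => by
      clear * - h0 h3
      ring)
  have Fl := integral_comb hsupp (F := fun x => if x ≤ 1 then (x - 1) ^ 2 else 0) (1) (-2) (1) (0)
    (NiceFn.low 2) (NiceFn.low 1) (NiceFn.low 0) (NiceFn.pow 0)
    (Filter.Eventually.of_forall fun x h0 h3 => by
      clear * - h0 h3
      try dsimp only
      split_ifs <;> ring)
  have Fh := integral_comb hsupp (F := fun x => if 2 ≤ x then (x - 1) ^ 2 else 0) (1) (2) (1) (0)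
    (NiceFn.high 2) (NiceFn.high 1) (NiceFn.high 0) (NiceFn.pow 0)
    (Filter.Eventually.of_forall fun x h0 h3 => by
      clear * - h0 h3
      try dsimp only
      split_ifs <;> ring)
  rw [E1, E2, E3]
  exact final_arith z M1 M2 A0 A1 A2 C0 C1 C2 Fp Fl Fh
end
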